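/- Let Σ be a set of EFD-systems in the language 𝓛 of ℓ-groups. Then either every abelian ℓ-group satisfying all members of Σ is trivial (a subsingleton), or there exists a unique set S of prime numbers such that for every abelian ℓ-group G: G satisfies every member of Σ if and only if for every prime p ∈ S and every x ∈ G there is exactly one z ∈ G with p • z = x. (In particular distinct sets of primes S determine distinct AE-subclasses of the class of abelian ℓ-groups.) -/

import Mathlib

open FirstOrder Language

/-- The binary function symbols of the language of ℓ-groups: `+`, `∨`, `∧`. -/
inductive LGrpBin : Type
  | add : LGrpBin
  | join : LGrpBin
  | meet : LGrpBin

/-- Function symbols of the language of ℓ-groups: a constant `0`, a unary `-`,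
and binary `+`, `∨`, `∧`. -/
def LGrpFunc : ℕ → Type
  | 0 => Unit
  | 1 => Unit
  | 2 => LGrpBin
  | _ => Empty

/-- The first-order language of (abelian) ℓ-groups. -/
def LGrpLang : FirstOrder.Language :=
  ⟨LGrpFunc, fun _ => Empty⟩

/-- The evident `LGrpLang`-structure on any abelian ℓ-group. -/
instance lgrpStructure (G : Type*) [Lattice G] [AddCommGroup G] :
    LGrpLang.Structure G where
  funMap {n} f x :=
    match n, f, x with
    | 0, _, _ => 0
    | 1, _, x => -(x 0)
    | 2, LGrpBin.add, x => x 0 + x 1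
    | 2, LGrpBin.join, x => x 0 ⊔ x 1
    | 2, LGrpBin.meet, x => x 0 ⊓ x 1
    | (_+3), f, _ => f.elim
  RelMap {_} r := r.elim

/-- An EFD-system in a language `L`: data for an EFD-sentence
`∀ x_1 … x_n ∃! z_1 … z_m, ⋀_{i<r} s_i(x̄,z̄) = t_i(x̄,z̄)` with `m, r ≥ 1`. -/
structure EFDSystem (L : FirstOrder.Language) where
  n : ℕ
  m : ℕ
  r : ℕ
  hm : 0 < m
  hr : 0 < r
  lhs : Fin r → L.Term (Fin n ⊕ Fin m)
  rhs : Fin r → L.Term (Fin n ⊕ Fin m)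

/-- A structure `G` satisfies an EFD-system if for every tuple `x` there is exactly one
tuple `z` solving all the equations. -/
def EFDSystem.Satisfies {L : FirstOrder.Language} (φ : EFDSystem L)
    (G : Type*) [L.Structure G] : Prop :=
  ∀ x : Fin φ.n → G, ∃! z : Fin φ.m → G, ∀ i : Fin φ.r,
    Term.realize (Sum.elim x z) (φ.lhs i) = Term.realize (Sum.elim x z) (φ.rhs i)

section LinearQuotient

open LatticeOrderedAddCommGroup

variable {H : Type*} [Lattice H] [AddCommGroup H] [IsOrderedAddMonoid H]

/-- The solid subgroup generated by a solid subgroup `P` and a nonnegative element `a`. -/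
def solidAdjoin (P : AddSubgroup H) (hP : IsSolid (P : Set H)) (a : H) :
    AddSubgroup H where
  carrier := {b | ∃ p ∈ P, ∃ n : ℕ, |b| ≤ |p| + n • a}
  zero_mem' := ⟨0, P.zero_mem, 0, by simp⟩
  neg_mem' := by
    rintro b ⟨p, hp, n, h⟩
    exact ⟨p, hp, n, by simpa using h⟩
  add_mem' := by
    rintro b c ⟨p, hp, n, hb⟩ ⟨q, hq, k, hc⟩
    have hp' : |p| ∈ P := hP hp (by simp)
    have hq' : |q| ∈ P := hP hq (by simp)
    refine ⟨|p| + |q|, P.add_mem hp' hq', n + k, ?_⟩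
    rw [abs_of_nonneg (add_nonneg (abs_nonneg p) (abs_nonneg q)), add_smul]
    calc |b + c| ≤ |b| + |c| := abs_add_le b c
      _ ≤ (|p| + n • a) + (|q| + k • a) := add_le_add hb hc
      _ = _ := by abel

theorem isSolid_solidAdjoin (P : AddSubgroup H) (hP : IsSolid (P : Set H)) (a : H) :
    IsSolid (solidAdjoin P hP a : Set H) := by
  rintro b ⟨p, hp, n, hb⟩ c hc
  exact ⟨p, hp, n, hc.trans hb⟩

theorem le_solidAdjoin (P : AddSubgroup H) (hP : IsSolid (P : Set H)) (a : H) :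
    P ≤ solidAdjoin P hP a :=
  fun p hp => ⟨p, hp, 0, by simp⟩

theorem mem_solidAdjoin_self (P : AddSubgroup H) (hP : IsSolid (P : Set H)) (a : H) (ha : 0 ≤ a) :
    a ∈ solidAdjoin P hP a :=
  ⟨0, P.zero_mem, 1, by simp [abs_of_nonneg ha]⟩

theorem inf_add_eq_zero {a b c : H} (hab : a ⊓ b = 0) (hac : a ⊓ c = 0) : a ⊓ (b + c) = 0 := by
  have ha : 0 ≤ a := hab ▸ inf_le_left
  have hb : 0 ≤ b := hab ▸ inf_le_right
  have hc : 0 ≤ c := hac ▸ inf_le_right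
  refine le_antisymm ?_ (le_inf ha (add_nonneg hb hc))
  have h : a ⊓ (b + c) - c ≤ a ⊓ b :=
    le_inf ((sub_le_self _ hc).trans inf_le_left) (by rw [sub_le_iff_le_add]; exact inf_le_right)
  rw [hab, sub_nonpos] at h
  exact hac ▸ le_inf inf_le_left h

theorem inf_nsmul_eq_zero {a b : H} (hab : a ⊓ b = 0) (n : ℕ) : a ⊓ n • b = 0 := by
  induction n with
  | zero => simpa using (hab ▸ inf_le_left : 0 ≤ a)
  | succ n ih => rw [add_smul, one_smul]; exact inf_add_eq_zero ih hab

theorem nsmul_inf_nsmul_eq_zero {a b : H} (hab : a ⊓ b = 0) (n k : ℕ) : n • a ⊓ k • b = 0 := by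
  rw [inf_comm]
  apply inf_nsmul_eq_zero
  rw [inf_comm]
  exact inf_nsmul_eq_zero hab k

/-- An element outside the solid subgroup generated by `α ≥ 0` is avoided by some prime
solid subgroup containing `α`. -/
theorem exists_prime_solid (α β : H) (hα : 0 ≤ α) (h : ∀ n : ℕ, ¬ |β| ≤ n • α) :
    ∃ P : AddSubgroup H, IsSolid (P : Set H) ∧ α ∈ P ∧ β ∉ P ∧
      ∀ a b : H, a ⊓ b = 0 → a ∈ P ∨ b ∈ P := by
  have hbot : IsSolid ((⊥ : AddSubgroup H) : Set H) := by
    intro a ha b hb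
    obtain rfl : a = 0 := by simpa using ha
    have hb : |b| ≤ 0 := by simpa using hb
    have h1 : b ≤ 0 := (le_abs_self b).trans hb
    have h2 : -b ≤ 0 := (neg_le_abs b).trans hb
    simpa using le_antisymm h1 (by simpa using h2)
  obtain ⟨P, -, hmax⟩ := zorn_le_nonempty₀
    {P : AddSubgroup H | IsSolid (P : Set H) ∧ α ∈ P ∧ β ∉ P} (by
      intro c hc hchain Q hQ
      have hmem : ∀ x, x ∈ sSup c ↔ ∃ s ∈ c, x ∈ s := fun x =>
        AddSubgroup.mem_sSup_of_directedOn ⟨Q, hQ⟩ hchain.directedOn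
      refine ⟨sSup c, ⟨?_, ?_, ?_⟩, fun s hs => le_sSup hs⟩
      · intro a ha b hb
        obtain ⟨s, hs, has⟩ := (hmem a).1 ha
        exact (hmem b).2 ⟨s, hs, (hc hs).1 has hb⟩
      · exact (hmem α).2 ⟨Q, hQ, (hc hQ).2.1⟩
      · intro hβ
        obtain ⟨s, hs, hβs⟩ := (hmem β).1 hβ
        exact (hc hs).2.2 hβs)
    (solidAdjoin ⊥ hbot α)
    ⟨isSolid_solidAdjoin _ _ _, mem_solidAdjoin_self _ _ _ hα, by
      rintro ⟨p, hp, n, hn⟩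
      obtain rfl : p = 0 := by simpa using hp
      exact h n (by simpa using hn)⟩
  obtain ⟨⟨hP, hαP, hβP⟩, hmax⟩ := hmax
  refine ⟨P, hP, hαP, hβP, fun a b hab => ?_⟩
  have key : ∀ a, 0 ≤ a → a ∉ P → ∃ p ∈ P, ∃ n : ℕ, |β| ≤ |p| + n • a := by
    intro a ha haP
    by_contra hβ
    exact haP (hmax ⟨isSolid_solidAdjoin P hP a, le_solidAdjoin P hP a hαP, hβ⟩
      (le_solidAdjoin P hP a) (mem_solidAdjoin_self P hP a ha))
  by_contra hcon
  push Not at hcon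
  have ha : 0 ≤ a := hab ▸ inf_le_left
  have hb : 0 ≤ b := hab ▸ inf_le_right
  obtain ⟨p, hp, n, hn⟩ := key a ha hcon.1
  obtain ⟨q, hq, k, hk⟩ := key b hb hcon.2
  refine hβP (hP (P.add_mem (hP hp (by simp) : |p| ∈ P) (hP hq (by simp) : |q| ∈ P)) ?_)
  rw [abs_of_nonneg (add_nonneg (abs_nonneg p) (abs_nonneg q))]
  rw [← sub_nonpos, ← nsmul_inf_nsmul_eq_zero hab n k]
  refine le_inf ?_ ?_
  · rw [sub_le_iff_le_add]
    calc |β| ≤ |p| + n • a := hn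
      _ ≤ |p| + n • a + |q| := le_add_of_nonneg_right (abs_nonneg q)
      _ = _ := by abel
  · rw [sub_le_iff_le_add]
    calc |β| ≤ |q| + k • b := hk
      _ ≤ |q| + k • b + |p| := le_add_of_nonneg_right (abs_nonneg p)
      _ = _ := by abel

/-- The quotient by a prime solid subgroup is linearly ordered. -/
theorem exists_linearOrder_quotient (P : AddSubgroup H) (hP : IsSolid (P : Set H))
    (hprime : ∀ a b : H, a ⊓ b = 0 → a ∈ P ∨ b ∈ P) :
    ∃ (_ : LinearOrder (H ⧸ P)) (_ : IsOrderedAddMonoid (H ⧸ P)),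
      ∀ a b : H, ((a ⊔ b : H) : H ⧸ P) = (a : H ⧸ P) ⊔ (b : H ⧸ P) := by
  classical
  let C : AddGroupCone (H ⧸ P) :=
    { carrier := {q | ∃ a : H, 0 ≤ a ∧ (a : H ⧸ P) = q}
      zero_mem' := ⟨0, le_rfl, rfl⟩
      add_mem' := by
        rintro _ _ ⟨a, ha, rfl⟩ ⟨b, hb, rfl⟩
        exact ⟨a + b, add_nonneg ha hb, rfl⟩
      eq_zero_of_mem_of_neg_mem' := by
        rintro _ ⟨a, ha, rfl⟩ ⟨b, hb, hab⟩
        have : a + b ∈ P := by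
          rw [← QuotientAddGroup.eq_zero_iff, QuotientAddGroup.mk_add, hab, add_neg_cancel]
        rw [QuotientAddGroup.eq_zero_iff]
        refine hP this ?_
        rw [abs_of_nonneg ha, abs_of_nonneg (add_nonneg ha hb)]
        exact le_add_of_nonneg_right hb }
  have hmem : ∀ q, q ∈ C ↔ ∃ a : H, 0 ≤ a ∧ (a : H ⧸ P) = q := fun q => Iff.rfl
  have hpos : ∀ a b : H, (b - a)⁺ ∈ P → ((a ⊔ b : H) : H ⧸ P) = a := by
    intro a b hab
    rw [sup_comm, sup_eq_add_posPart_sub, QuotientAddGroup.mk_add,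
      (QuotientAddGroup.eq_zero_iff _).2 hab, add_zero]
  have hdisj : ∀ a b : H, (b - a)⁺ ∈ P ∨ (a - b)⁺ ∈ P := by
    intro a b
    apply hprime
    rw [← neg_sub b a, posPart_neg]
    exact posPart_inf_negPart_eq_zero _
  have htot : HasMemOrNegMem C := by
    constructor
    intro q
    induction q using QuotientAddGroup.induction_on with
    | H a =>
      rcases hdisj 0 a with h | h
      · right
        refine ⟨0 ⊔ a - a, by simp, ?_⟩
        rw [QuotientAddGroup.mk_sub, hpos 0 a h]; simp
      · left
        refine ⟨a ⊔ 0, by simp, hpos a 0 h⟩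
  let _ : LinearOrder (H ⧸ P) := LinearOrder.mkOfAddGroupCone C
  have hord : IsOrderedAddMonoid (H ⧸ P) := IsOrderedAddMonoid.mkOfCone C
  have hmono : ∀ a b : H, a ≤ b → (a : H ⧸ P) ≤ b := fun a b hab =>
    (hmem _).2 ⟨b - a, sub_nonneg.2 hab, rfl⟩
  refine ⟨inferInstance, hord, fun a b => ?_⟩
  rcases hdisj a b with h | h
  · have h1 := hpos a b h
    rw [h1, eq_comm, sup_eq_left, ← h1]
    exact hmono _ _ le_sup_right
  · have h1 := hpos b a h
    rw [sup_comm, sup_comm (a : H ⧸ P), h1, eq_comm, sup_eq_left, ← h1]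
    exact hmono _ _ le_sup_right

theorem exists_linear_quotient {H : Type} [Lattice H] [AddCommGroup H] [IsOrderedAddMonoid H]
    (α β : H) (hα : 0 ≤ α) (h : ∀ n : ℕ, ¬ |β| ≤ n • α) :
    ∃ (T : Type) (_ : AddCommGroup T) (_ : LinearOrder T) (_ : IsOrderedAddMonoid T) (π : H →+ T),
      (∀ a b, π (a ⊔ b) = π a ⊔ π b) ∧ π α = 0 ∧ π β ≠ 0 := by
  obtain ⟨P, hP, hα, hβ, hprime⟩ := exists_prime_solid α β hα h
  obtain ⟨i, j, hsup⟩ := exists_linearOrder_quotient P hP hprime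
  exact ⟨H ⧸ P, inferInstance, i, j, QuotientAddGroup.mk' P, hsup,
    (QuotientAddGroup.eq_zero_iff _).2 hα, fun h => hβ ((QuotientAddGroup.eq_zero_iff _).1 h)⟩

theorem exists_linear_quotient_of_ne_zero {H : Type} [Lattice H] [AddCommGroup H]
    [IsOrderedAddMonoid H] (β : H) (hβ : β ≠ 0) :
    ∃ (T : Type) (_ : AddCommGroup T) (_ : LinearOrder T) (_ : IsOrderedAddMonoid T) (π : H →+ T),
      (∀ a b, π (a ⊔ b) = π a ⊔ π b) ∧ π β ≠ 0 := by
  obtain ⟨T, i1, i2, i3, π, hπ, -, h⟩ := exists_linear_quotient 0 β le_rfl (by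
    intro n hn
    rw [smul_zero] at hn
    exact hβ (le_antisymm ((le_abs_self β).trans hn) (by simpa using (neg_le_abs β).trans hn)))
  exact ⟨T, i1, i2, i3, π, hπ, h⟩

end LinearQuotient

/-- Terms of the language of ℓ-groups. -/
inductive LGrpTerm (α : Type) : Type
  | var : α → LGrpTerm α
  | zero : LGrpTerm α
  | neg : LGrpTerm α → LGrpTerm α
  | add : LGrpTerm α → LGrpTerm α → LGrpTerm α
  | sup : LGrpTerm α → LGrpTerm α → LGrpTerm α

namespace LGrpTerm

variable {α β : Type}

/-- The value of a term under an assignment of its variables. -/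
def eval {G : Type*} [Lattice G] [AddCommGroup G] (w : α → G) : LGrpTerm α → G
  | var a => w a
  | zero => 0
  | neg t => -eval w t
  | add s t => eval w s + eval w t
  | sup s t => eval w s ⊔ eval w t

/-- Renaming of variables. -/
def rename (f : α → β) : LGrpTerm α → LGrpTerm β
  | var a => var (f a)
  | zero => zero
  | neg t => neg (rename f t)
  | add s t => add (rename f s) (rename f t)
  | sup s t => sup (rename f s) (rename f t)

theorem eval_rename {G : Type*} [Lattice G] [AddCommGroup G] (f : α → β) (w : β → G)
    (t : LGrpTerm α) : eval w (rename f t) = eval (w ∘ f) t := by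
  induction t <;> simp_all [eval, rename]

theorem eval_comp {A B : Type*} [Lattice A] [AddCommGroup A] [Lattice B] [AddCommGroup B]
    (f : A →+ B) (hf : ∀ a b, f (a ⊔ b) = f a ⊔ f b) (w : α → A) (t : LGrpTerm α) :
    eval (f ∘ w) t = f (eval w t) := by
  induction t <;> simp_all [eval]

theorem exists_eval_eq_realize (t : LGrpLang.Term α) :
    ∃ t' : LGrpTerm α, ∀ (G : Type) [Lattice G] [AddCommGroup G] [IsOrderedAddMonoid G]
      (w : α → G), eval w t' = t.realize w := by
  induction t with
  | var a => exact ⟨var a, fun G _ _ _ w => rfl⟩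
  | @func l f ts ih =>
    choose s hs using ih
    match l, f with
    | 0, f =>
      exact ⟨zero, fun G _ _ _ w => rfl⟩
    | 1, f =>
      refine ⟨neg (s 0), fun G _ _ _ w => ?_⟩
      rw [eval, hs]; rfl
    | 2, LGrpBin.add =>
      refine ⟨add (s 0) (s 1), fun G _ _ _ w => ?_⟩
      rw [eval, hs, hs]; rfl
    | 2, LGrpBin.join =>
      refine ⟨sup (s 0) (s 1), fun G _ _ _ w => ?_⟩
      rw [eval, hs, hs]; rfl
    | 2, LGrpBin.meet =>
      refine ⟨neg (sup (neg (s 0)) (neg (s 1))), fun G _ _ _ w => ?_⟩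
      rw [eval, eval, eval, eval, hs, hs, neg_sup, neg_neg, neg_neg]; rfl
    | (_ + 3), f => exact f.elim

/-- A finite system of equations is equivalent to a single equation `δ = 0`. -/
theorem exists_eval_eq_zero_iff {ι : Type*} (I : Finset ι) (s t : ι → LGrpLang.Term α) :
    ∃ δ : LGrpTerm α, ∀ (G : Type) [Lattice G] [AddCommGroup G] [IsOrderedAddMonoid G]
      (w : α → G), 0 ≤ eval w δ ∧
        (eval w δ = 0 ↔ ∀ i ∈ I, (s i).realize w = (t i).realize w) := by
  classical
  induction I using Finset.induction_on with
  | empty => exact ⟨zero, fun G _ _ _ w => by simp [eval]⟩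
  | insert i I _ ih =>
    obtain ⟨δ, hδ⟩ := ih
    obtain ⟨s', hs⟩ := exists_eval_eq_realize (s i)
    obtain ⟨t', ht⟩ := exists_eval_eq_realize (t i)
    refine ⟨add δ (sup (add s' (neg t')) (neg (add s' (neg t')))), fun G _ _ _ w => ?_⟩
    have h : eval w (add δ (sup (add s' (neg t')) (neg (add s' (neg t'))))) =
        eval w δ + |(s i).realize w - (t i).realize w| := by
      simp only [eval, hs, ht, ← sub_eq_add_neg]; rfl
    rw [h]
    have h0 := (hδ G w).1
    refine ⟨add_nonneg h0 (abs_nonneg _), ?_⟩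
    rw [add_eq_zero_iff_of_nonneg h0 (abs_nonneg _), (hδ G w).2, Finset.forall_mem_insert,
      and_comm]
    refine and_congr_left fun _ => ⟨fun h => ?_, fun h => by simp [h]⟩
    have h1 := (le_abs_self _).trans h.le
    have h2 := (neg_le_abs _).trans h.le
    rw [neg_sub, sub_nonpos] at h2
    exact le_antisymm (sub_nonpos.1 h1) h2

end LGrpTerm

section SameSign

/-- `x` and `y` are both positive, both zero or both negative. -/
def SameSign {A B : Type*} [Zero A] [LT A] [Zero B] [LT B] (x : A) (y : B) : Prop :=
  (0 < x ↔ 0 < y) ∧ (x < 0 ↔ y < 0)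

theorem SameSign.eq_zero_iff {T : Type*} [AddCommGroup T] [LinearOrder T] {x : T} {y : ℚ}
    (h : SameSign x y) : x = 0 ↔ y = 0 := by
  rw [← not_iff_not, ← ne_eq, ← ne_eq, ne_iff_lt_or_gt, ne_iff_lt_or_gt, h.1, h.2]

variable {T : Type*} [AddCommGroup T] [LinearOrder T] [IsOrderedAddMonoid T]

theorem SameSign.of_neg {x : T} {y : ℚ} (h : SameSign (-x) (-y)) : SameSign x y := by
  simpa [SameSign, and_comm] using h

theorem SameSign.of_zsmul {x : T} {y : ℚ} {e : ℤ} (he : e ≠ 0) (h : SameSign (e • x) (e * y)) :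
    SameSign x y := by
  have key : ∀ {e : ℤ} {x : T} {y : ℚ}, 0 < e → SameSign (e • x) (e * y) → SameSign x y := by
    intro e x y he h
    have he' : (0 : ℚ) < e := by exact_mod_cast he
    refine ⟨?_, ?_⟩
    · rw [← smul_pos_iff_of_pos_left he, h.1, mul_pos_iff_of_pos_left he']
    · rw [← neg_pos, ← smul_pos_iff_of_pos_left he, smul_neg, neg_pos, h.2, mul_neg_iff]
      simp [he', he'.le.not_gt]
  rcases lt_or_gt_of_ne he with h0 | h0
  · refine SameSign.of_neg (key (e := -e) (neg_pos.2 h0) ?_)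
    simpa using h
  · exact key h0 h

theorem exists_rat_same_position {ι : Type*} (s : Finset ι) (a : ι → T) (b : ι → ℚ)
    (h : ∀ i ∈ s, ∀ j ∈ s, SameSign (a i - a j) (b i - b j)) (t : T) :
    ∃ τ : ℚ, ∀ i ∈ s, SameSign (t - a i) (τ - b i) := by
  classical
  by_cases hex : ∃ i ∈ s, a i = t
  · obtain ⟨i, hi, rfl⟩ := hex
    exact ⟨b i, fun j hj => h i hi j hj⟩
  · push Not at hex
    obtain ⟨τ, hlo, hhi⟩ := Order.exists_between_finsets ((s.filter (a · < t)).image b)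
      ((s.filter (t < a ·)).image b) (by
        intro x hx y hy
        simp only [Finset.mem_image, Finset.mem_filter] at hx hy
        obtain ⟨i, ⟨hi, hit⟩, rfl⟩ := hx
        obtain ⟨j, ⟨hj, hjt⟩, rfl⟩ := hy
        have := (h i hi j hj).2
        rw [sub_neg, sub_neg] at this
        exact this.1 (hit.trans hjt))
    refine ⟨τ, fun i hi => ?_⟩
    rcases lt_or_gt_of_ne (hex i hi) with hlt | hgt
    · have := hlo (b i) (Finset.mem_image_of_mem b (Finset.mem_filter.2 ⟨hi, hlt⟩))
      simp [SameSign, hlt, this, hlt.not_gt, this.not_gt]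
    · have := hhi (b i) (Finset.mem_image_of_mem b (Finset.mem_filter.2 ⟨hi, hgt⟩))
      simp [SameSign, hgt, this, hgt.not_gt, this.not_gt]

theorem exists_rat_sameSign_fin (N : ℕ) (y : Fin N → T) (Λ : Finset (Fin N → ℤ)) :
    ∃ y' : Fin N → ℚ, ∀ l ∈ Λ, SameSign (∑ i, l i • y i) (∑ i, l i * y' i) := by
  classical
  induction N with
  | zero => exact ⟨0, fun l _ => by simp [SameSign]⟩
  | succ N ih =>
    let Λ₀ := Λ.filter (fun l => l (Fin.last N) ≠ 0)
    let C : ℤ := ∏ l ∈ Λ₀, l (Fin.last N)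
    have hC : C ≠ 0 := Finset.prod_ne_zero_iff.2 fun l hl => (Finset.mem_filter.1 hl).2
    have hdvd : ∀ l : Fin (N + 1) → ℤ, ∃ e : ℤ, l ∈ Λ₀ → e * l (Fin.last N) = C := by
      intro l
      by_cases hl : l ∈ Λ₀
      · obtain ⟨e, he⟩ := Finset.dvd_prod_of_mem (fun l : Fin (N + 1) → ℤ => l (Fin.last N)) hl
        exact ⟨e, fun _ => by rw [mul_comm]; exact he.symm⟩
      · exact ⟨0, fun h => absurd h hl⟩
    choose e he using hdvd
    let m : (Fin (N + 1) → ℤ) → Fin N → ℤ := fun l i => -(e l * l i.castSucc)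
    obtain ⟨y', hy'⟩ := ih (fun i => y i.castSucc)
      (Λ.image (fun l i => l i.castSucc) ∪ (Λ₀ ×ˢ Λ₀).image (fun p => m p.1 - m p.2))
    obtain ⟨τ, hτ⟩ := exists_rat_same_position Λ₀
      (fun l => ∑ i, m l i • y i.castSucc) (fun l => ∑ i, m l i * y' i) (by
        intro l hl l' hl'
        have := hy' (m l - m l') (Finset.mem_union_right _
          (Finset.mem_image.2 ⟨(l, l'), Finset.mem_product.2 ⟨hl, hl'⟩, rfl⟩))
        simpa [sub_smul, sub_mul, Finset.sum_sub_distrib] using this) (C • y (Fin.last N))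
    refine ⟨Fin.snoc y' (τ / C), fun l hl => ?_⟩
    rw [Fin.sum_univ_castSucc, Fin.sum_univ_castSucc]
    simp only [Fin.snoc_castSucc, Fin.snoc_last]
    by_cases h0 : l (Fin.last N) = 0
    · simpa [h0] using hy' (fun i => l i.castSucc)
        (Finset.mem_union_left _ (Finset.mem_image_of_mem _ hl))
    · have hl0 : l ∈ Λ₀ := Finset.mem_filter.2 ⟨hl, h0⟩
      have hel := he l hl0
      refine SameSign.of_zsmul (e := e l)
        (by rintro h; rw [h, zero_mul] at hel; exact hC hel.symm) ?_
      have hq : (e l : ℚ) * l (Fin.last N) = C := by exact_mod_cast hel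
      have hCq : (C : ℚ) ≠ 0 := by exact_mod_cast hC
      have h1 : e l • (∑ i : Fin N, l i.castSucc • y i.castSucc + l (Fin.last N) • y (Fin.last N)) =
          C • y (Fin.last N) - ∑ i, m l i • y i.castSucc := by
        simp only [m, smul_add, Finset.smul_sum, smul_smul, hel, neg_smul, Finset.sum_neg_distrib]
        abel
      have h2 : (e l : ℚ) * (∑ i : Fin N, l i.castSucc * y' i + l (Fin.last N) * (τ / C)) =
          τ - ∑ i, m l i * y' i := by
        rw [mul_add, ← mul_assoc, hq, mul_div_cancel₀ _ hCq]
        simp only [m, Finset.mul_sum, Int.cast_neg, Int.cast_mul, neg_mul, Finset.sum_neg_distrib,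
          mul_assoc]
        ring
      rw [h1, h2]
      exact hτ l hl0

theorem exists_rat_sameSign {α : Type*} [Fintype α] (y : α → T) (Λ : Finset (α → ℤ)) :
    ∃ y' : α → ℚ, ∀ l ∈ Λ, SameSign (∑ i, l i • y i) (∑ i, l i * y' i) := by
  classical
  let e := Fintype.equivFin α
  obtain ⟨y', h⟩ := exists_rat_sameSign_fin _ (y ∘ e.symm) (Λ.image (· ∘ e.symm))
  refine ⟨y' ∘ e, fun l hl => ?_⟩
  have := h _ (Finset.mem_image_of_mem _ hl)
  rw [← e.sum_comp, ← e.sum_comp] at this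
  simpa using this

end SameSign

namespace LGrpTerm

variable {α : Type} [Fintype α]

/-- On a linearly ordered group, the value of a term at a point is given by an integral linear form
which depends only on the signs of finitely many integral linear forms at that point. -/
theorem exists_eval_eq_sum {T : Type*} [AddCommGroup T] [LinearOrder T] [IsOrderedAddMonoid T]
    (y : α → T) (t : LGrpTerm α) :
    ∃ (l : α → ℤ) (Λ : Finset (α → ℤ)), eval y t = ∑ i, l i • y i ∧
      ∀ y' : α → ℚ, (∀ k ∈ Λ, SameSign (∑ i, k i • y i) (∑ i, k i * y' i)) →
        eval y' t = ∑ i, l i * y' i := by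
  classical
  induction t with
  | var a => exact ⟨Pi.single a 1, ∅, by simp [eval, Pi.single_apply],
      fun y' _ => by simp [eval, Pi.single_apply]⟩
  | zero => exact ⟨0, ∅, by simp [eval], fun y' _ => by simp [eval]⟩
  | neg t ih =>
    obtain ⟨l, Λ, h, h'⟩ := ih
    exact ⟨-l, Λ, by simp [eval, h], fun y' hy' => by simp [eval, h' y' hy']⟩
  | add s t ihs iht =>
    obtain ⟨l, Λ, h, h'⟩ := ihs
    obtain ⟨k, Γ, g, g'⟩ := iht
    refine ⟨l + k, Λ ∪ Γ, by simp [eval, h, g, add_smul, Finset.sum_add_distrib],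
      fun y' hy' => ?_⟩
    rw [eval, h' y' fun k hk => hy' k (Finset.mem_union_left _ hk),
      g' y' fun k hk => hy' k (Finset.mem_union_right _ hk)]
    simp [add_mul, Finset.sum_add_distrib]
  | sup s t ihs iht =>
    obtain ⟨l, Λ, h, h'⟩ := ihs
    obtain ⟨k, Γ, g, g'⟩ := iht
    have hsign : ∀ y' : α → ℚ, (∀ j ∈ insert (l - k) (Λ ∪ Γ),
        SameSign (∑ i, j i • y i) (∑ i, j i * y' i)) →
        (eval y' s = ∑ i, l i * y' i ∧ eval y' t = ∑ i, k i * y' i) ∧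
        SameSign (∑ i, l i • y i - ∑ i, k i • y i) (∑ i, l i * y' i - ∑ i, k i * y' i) := by
      intro y' hy'
      refine ⟨⟨h' y' fun k hk => hy' k (by simp [hk]), g' y' fun k hk => hy' k (by simp [hk])⟩, ?_⟩
      simpa [sub_smul, sub_mul, Finset.sum_sub_distrib] using hy' (l - k) (by simp)
    rcases le_total (eval y s) (eval y t) with hle | hle
    · refine ⟨k, insert (l - k) (Λ ∪ Γ), by rw [eval, sup_eq_right.2 hle, g], fun y' hy' => ?_⟩
      obtain ⟨⟨e1, e2⟩, hs⟩ := hsign y' hy'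
      rw [eval, e1, e2, sup_eq_right, ← sub_nonpos, ← not_lt, ← hs.1, not_lt, sub_nonpos,
        ← h, ← g]
      exact hle
    · refine ⟨l, insert (l - k) (Λ ∪ Γ), by rw [eval, sup_eq_left.2 hle, h], fun y' hy' => ?_⟩
      obtain ⟨⟨e1, e2⟩, hs⟩ := hsign y' hy'
      rw [eval, e1, e2, sup_eq_left, ← sub_nonneg, ← not_lt, ← hs.2, not_lt, sub_nonneg,
        ← h, ← g]
      exact hle

/-- Finitely many term equations, linear equations and their negations which hold at a point of a
linearly ordered group hold at some rational point. -/
theorem exists_rat_point {T : Type*} [AddCommGroup T] [LinearOrder T] [IsOrderedAddMonoid T]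
    (y : α → T) (τ : Finset (LGrpTerm α)) (Λ : Finset (α → ℤ)) :
    ∃ y' : α → ℚ, (∀ t ∈ τ, (eval y t = 0 ↔ eval y' t = 0)) ∧
      ∀ l ∈ Λ, SameSign (∑ i, l i • y i) (∑ i, l i * y' i) := by
  classical
  choose l Γ h h' using fun t : LGrpTerm α => exists_eval_eq_sum y t
  obtain ⟨y', hy'⟩ := exists_rat_sameSign y (Λ ∪ τ.image l ∪ τ.biUnion Γ)
  refine ⟨y', fun t ht => ?_, fun l hl => hy' l (by simp [hl])⟩
  rw [h, h' t y' fun k hk => hy' k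
    (Finset.mem_union_right _ (Finset.mem_biUnion.2 ⟨t, ht, hk⟩))]
  exact (hy' (l t) (Finset.mem_union_left _
    (Finset.mem_union_right _ (Finset.mem_image_of_mem l ht)))).eq_zero_iff

end LGrpTerm

section TorsionFree

variable {G : Type} [Lattice G] [AddCommGroup G] [IsOrderedAddMonoid G]

theorem eq_zero_of_nsmul_eq_zero {k : ℕ} (hk : k ≠ 0) {g : G} (h : k • g = 0) : g = 0 := by
  by_contra hg
  obtain ⟨T, _, _, _, π, -, hπ⟩ := exists_linear_quotient_of_ne_zero g hg
  have := congrArg π h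
  rw [map_nsmul, map_zero, smul_eq_zero] at this
  exact this.elim hk hπ

theorem eq_of_nsmul_eq_nsmul {k : ℕ} (hk : k ≠ 0) {a b : G} (h : k • a = k • b) : a = b :=
  sub_eq_zero.1 (eq_zero_of_nsmul_eq_zero hk (by rw [smul_sub, h, sub_self]))

theorem zsmul_left_injective_of_ne_zero {g : G} (hg : g ≠ 0) {k l : ℤ} (h : k • g = l • g) :
    k = l := by
  obtain ⟨T, _, _, _, π, -, hπ⟩ := exists_linear_quotient_of_ne_zero g hg
  have := congrArg π h
  rw [map_zsmul, map_zsmul, ← sub_eq_zero, ← sub_smul, smul_eq_zero] at this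
  exact sub_eq_zero.1 (this.resolve_right hπ)

theorem nsmul_sup_distrib (k : ℕ) (a b : G) : k • (a ⊔ b) = k • a ⊔ k • b := by
  by_contra hne
  obtain ⟨T, _, _, _, π, hsup, hπ⟩ := exists_linear_quotient_of_ne_zero _ (sub_ne_zero.2 hne)
  apply hπ
  rw [map_sub, sub_eq_zero, map_nsmul, hsup, hsup, map_nsmul, map_nsmul]
  exact Monotone.map_sup (fun x y hxy => nsmul_le_nsmul_right hxy k) _ _

theorem eq_zero_or_exists_pos (G : Type) [Lattice G] [AddCommGroup G] [IsOrderedAddMonoid G] :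
    Subsingleton G ∨ ∃ g : G, 0 ≤ g ∧ g ≠ 0 := by
  by_cases h : ∃ g : G, 0 ≤ g ∧ g ≠ 0
  · exact Or.inr h
  · push Not at h
    refine Or.inl ⟨fun a b => sub_eq_zero.1 ?_⟩
    rw [← posPart_sub_negPart (a - b), h _ (posPart_nonneg _), h _ (negPart_nonneg _), sub_zero]

end TorsionFree

theorem exists_nat_mul_eq_intCast {α : Type*} [Fintype α] (w : α → ℚ) :
    ∃ N : ℕ, N ≠ 0 ∧ (∀ p : ℕ, p.Prime → p ∣ N → ∃ i, p ∣ (w i).den) ∧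
      ∃ k : α → ℤ, ∀ i, (N : ℚ) * w i = k i := by
  classical
  refine ⟨∏ i, (w i).den, Finset.prod_ne_zero_iff.2 fun i _ => (w i).den_nz, fun p hp h => ?_,
    fun i => (∏ j ∈ Finset.univ.erase i, ((w j).den : ℤ)) * (w i).num, fun i => ?_⟩
  · obtain ⟨i, -, hi⟩ := hp.prime.exists_mem_finset_dvd h
    exact ⟨i, hi⟩
  · rw [← Finset.prod_erase_mul _ _ (Finset.mem_univ i)]
    push_cast
    rw [mul_assoc, mul_comm ((w i).den : ℚ), Rat.mul_den_eq_num]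

namespace LGrpTerm

variable {α : Type}

theorem eval_nsmul {G : Type} [Lattice G] [AddCommGroup G] [IsOrderedAddMonoid G]
    (k : ℕ) (w : α → G) (t : LGrpTerm α) : eval (fun i => k • w i) t = k • eval w t :=
  eval_comp (nsmulAddMonoidHom (α := G) k) (nsmul_sup_distrib k) w t

theorem eval_rat_mul {q : ℚ} (hq : 0 ≤ q) (w : α → ℚ) (t : LGrpTerm α) :
    eval (fun i => q * w i) t = q * eval w t :=
  eval_comp (AddMonoidHom.mulLeft q) (fun a b => mul_max_of_nonneg a b hq) w t

theorem eval_zsmul {G : Type*} [Lattice G] [AddCommGroup G] [IsOrderedAddMonoid G] {g : G}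
    (hg : 0 ≤ g) (k : α → ℤ) (t : LGrpTerm α) : eval (fun i => k i • g) t = eval k t • g :=
  eval_comp (zmultiplesHom G g)
    (fun _ _ => Monotone.map_sup (fun _ _ h => zsmul_left_mono hg h) _ _) k t

theorem eval_intCast (k : α → ℤ) (t : LGrpTerm α) :
    eval (fun i => (k i : ℚ)) t = (eval k t : ℤ) :=
  eval_comp (Int.castAddHom ℚ) (fun _ _ => Int.cast_max) k t

/-- A rational solution of a term equation yields solutions along any nonnegative element. -/
theorem eval_zsmul_eq_zero {G : Type*} [Lattice G] [AddCommGroup G] [IsOrderedAddMonoid G] {g : G}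
    (hg : 0 ≤ g) {w : α → ℚ} {N : ℕ} {k : α → ℤ} (hk : ∀ i, (N : ℚ) * w i = k i)
    {t : LGrpTerm α} (ht : eval w t = 0) : eval (fun i => k i • g) t = 0 := by
  have h : eval k t = 0 := by
    rw [← Int.cast_eq_zero (α := ℚ), ← eval_intCast, ← funext hk, eval_rat_mul N.cast_nonneg, ht,
      mul_zero]
  rw [eval_zsmul hg, h, zero_smul]

end LGrpTerm

section UniquelySolvable

open LGrpTerm

variable {n m : ℕ}

/-- The equation `δ(x, z) = 0` has exactly one solution `z` for every `x`. -/
def UniquelySolvable (δ : LGrpTerm (Fin n ⊕ Fin m)) (G : Type) [Lattice G] [AddCommGroup G] :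
    Prop :=
  ∀ x : Fin n → G, ∃! z : Fin m → G, eval (Sum.elim x z) δ = 0

theorem EFDSystem.exists_satisfies_iff (φ : EFDSystem LGrpLang) :
    ∃ δ : LGrpTerm (Fin φ.n ⊕ Fin φ.m), ∀ (G : Type) [Lattice G] [AddCommGroup G]
      [IsOrderedAddMonoid G], φ.Satisfies G ↔ UniquelySolvable δ G := by
  obtain ⟨δ, hδ⟩ := exists_eval_eq_zero_iff Finset.univ φ.lhs φ.rhs
  refine ⟨δ, fun G _ _ _ => ?_⟩
  simp only [EFDSystem.Satisfies, UniquelySolvable, (hδ G _).2, Finset.mem_univ, true_imp_iff]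

variable {δ : LGrpTerm (Fin n ⊕ Fin m)} {G : Type} [Lattice G] [AddCommGroup G]
  [IsOrderedAddMonoid G]

theorem UniquelySolvable.eq_of_rat (hG : UniquelySolvable δ G) {g : G} (hg : 0 ≤ g) (hg0 : g ≠ 0)
    {x : Fin n → ℚ} {z z' : Fin m → ℚ} (hz : eval (Sum.elim x z) δ = 0)
    (hz' : eval (Sum.elim x z') δ = 0) : z = z' := by
  obtain ⟨N, hN, -, k, hk⟩ := exists_nat_mul_eq_intCast (Sum.elim x (Sum.elim z z'))
  have h : eval (Sum.elim (fun i => k (.inl i) • g) (fun j => k (.inr (.inl j)) • g)) δ = 0 := by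
    convert eval_zsmul_eq_zero hg (N := N) (k := Sum.elim (k ∘ .inl) (k ∘ .inr ∘ .inl))
      (fun i => ?_) hz using 2
    · ext i; rcases i with i | i <;> rfl
    · rcases i with i | i
      · exact hk (.inl i)
      · exact hk (.inr (.inl i))
  have h' : eval (Sum.elim (fun i => k (.inl i) • g) (fun j => k (.inr (.inr j)) • g)) δ = 0 := by
    convert eval_zsmul_eq_zero hg (N := N) (k := Sum.elim (k ∘ .inl) (k ∘ .inr ∘ .inr))
      (fun i => ?_) hz' using 2
    · ext i; rcases i with i | i <;> rfl
    · rcases i with i | i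
      · exact hk (.inl i)
      · exact hk (.inr (.inr i))
  ext j
  have hj : k (.inr (.inl j)) = k (.inr (.inr j)) :=
    zsmul_left_injective_of_ne_zero hg0 (congrFun ((hG _).unique h h') j)
  have h1 := hk (.inr (.inl j))
  have h2 := hk (.inr (.inr j))
  rw [hj, ← h2] at h1
  exact mul_left_cancel₀ (Nat.cast_ne_zero.2 hN) h1

theorem UniquelySolvable.exists_rat (hG : UniquelySolvable δ G) {g : G} (hg : 0 ≤ g) (hg0 : g ≠ 0)
    (x : Fin n → ℚ) : ∃ z : Fin m → ℚ, eval (Sum.elim x z) δ = 0 := by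
  classical
  obtain ⟨N, hN, -, a, ha⟩ := exists_nat_mul_eq_intCast x
  obtain ⟨h, hh, -⟩ := hG fun i => a i • g
  obtain ⟨T, _, _, _, π, hsup, hπ⟩ := exists_linear_quotient_of_ne_zero g hg0
  have hπg : 0 < π g := by
    refine lt_of_le_of_ne ?_ hπ.symm
    rw [← sup_eq_right.2 hg, hsup, map_zero]
    exact le_sup_left
  let y : Unit ⊕ (Fin n ⊕ Fin m) → T :=
    Sum.elim (fun _ => π g) (π ∘ Sum.elim (fun i => a i • g) h)
  let c : Fin n → Unit ⊕ (Fin n ⊕ Fin m) → ℤ := fun i =>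
    Pi.single (.inr (.inl i)) 1 - Pi.single (.inl ()) (a i)
  obtain ⟨y', hy', hΛ⟩ := exists_rat_point y {rename Sum.inr δ}
    (insert (Pi.single (.inl ()) 1) (Finset.univ.image c))
  have hγ : 0 < y' (.inl ()) := by
    have := (hΛ _ (Finset.mem_insert_self _ _)).1
    simp only [Pi.single_apply, ite_smul, one_smul, zero_smul, Finset.sum_ite_eq',
      Finset.mem_univ, if_true, Int.cast_ite, Int.cast_one, Int.cast_zero, ite_mul, one_mul,
      zero_mul] at this
    exact this.1 hπg
  have hx : ∀ i, y' (.inr (.inl i)) = a i * y' (.inl ()) := by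
    intro i
    have := (hΛ (c i) (Finset.mem_insert_of_mem
      (Finset.mem_image_of_mem _ (Finset.mem_univ i)))).eq_zero_iff
    simp only [c, Pi.sub_apply, Pi.single_apply, sub_smul, ite_smul, one_smul, zero_smul,
      Finset.sum_ite_eq', Finset.sum_sub_distrib, Finset.mem_univ, if_true, Int.cast_sub,
      Int.cast_ite, Int.cast_one, Int.cast_zero, sub_mul, ite_mul, one_mul, zero_mul] at this
    exact sub_eq_zero.1 (this.1 (by simp [y]))
  have hδ : eval (y' ∘ Sum.inr) δ = 0 := by
    rw [← eval_rename, ← hy' _ (Finset.mem_singleton_self _), eval_rename]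
    change eval (π ∘ _) δ = 0
    rw [eval_comp π hsup, hh, map_zero]
  have hN' : (N : ℚ) ≠ 0 := Nat.cast_ne_zero.2 hN
  refine ⟨fun j => (N * y' (.inl ()))⁻¹ * y' (.inr (.inr j)), ?_⟩
  have := eval_rat_mul (q := (N * y' (.inl ()))⁻¹) (by positivity) (y' ∘ Sum.inr) δ
  rw [hδ, mul_zero] at this
  rw [← this]
  congr 1
  ext i
  rcases i with i | i
  · simp only [Sum.elim_inl, Function.comp_apply, hx, ← ha]
    field_simp
  · rfl

theorem UniquelySolvable.exists_nsmul_eq (hG : UniquelySolvable δ G) {x : Fin n → ℤ}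
    {z : Fin m → ℚ} (hz : eval (Sum.elim (fun i => (x i : ℚ)) z) δ = 0) (g : G) (j : Fin m) :
    ∃ h : G, (z j).den • h = (z j).num • g := by
  have key : ∀ g : G, 0 ≤ g → ∃ h : G, (z j).den • h = (z j).num • g := by
    intro g hg
    obtain ⟨h, hh, -⟩ := hG fun i => x i • g
    obtain ⟨N, hN, -, k, hk⟩ := exists_nat_mul_eq_intCast z
    have h1 : eval (Sum.elim (fun i => N • x i • g) (fun j => k j • g)) δ = 0 := by
      convert eval_zsmul_eq_zero hg (N := N) (k := Sum.elim (fun i => N * x i) k)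
        (fun i => ?_) hz using 2
      · ext i; rcases i with i | i <;> simp [mul_smul]
      · rcases i with i | i
        · simp
        · exact hk i
    have h2 : eval (Sum.elim (fun i => N • x i • g) (fun j => N • h j)) δ = 0 := by
      have := eval_nsmul N (Sum.elim (fun i => x i • g) h) δ
      rw [hh, smul_zero] at this
      rw [← this]
      congr 1
      ext i; rcases i with i | i <;> rfl
    have h3 : N • h j = k j • g := congrFun ((hG _).unique h2 h1) j
    refine ⟨h j, eq_of_nsmul_eq_nsmul hN ?_⟩
    have h4 : (N : ℤ) * (z j).num = (z j).den * k j := by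
      have : (N : ℚ) * (z j).num = (z j).den * k j := by
        rw [← hk j, ← Rat.mul_den_eq_num (z j)]; ring
      exact_mod_cast this
    rw [smul_comm, h3, ← natCast_zsmul, ← natCast_zsmul, smul_smul, smul_smul, h4]
  obtain ⟨h, hh⟩ := key g⁺ (posPart_nonneg g)
  obtain ⟨h', hh'⟩ := key g⁻ (negPart_nonneg g)
  exact ⟨h - h', by rw [smul_sub, hh, hh', ← smul_sub, posPart_sub_negPart]⟩

end UniquelySolvable

section PiecewiseLinear

open LGrpTerm Topology Filter

theorem LGrpTerm.continuous_eval {α : Type} (t : LGrpTerm α) :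
    Continuous fun w : α → ℚ => eval w t := by
  induction t with
  | var a => exact continuous_apply a
  | zero => exact continuous_const
  | neg t ih => exact ih.neg
  | add s t ihs iht => exact ihs.add iht
  | sup s t ihs iht => exact ihs.sup iht

theorem LGrpTerm.exists_finset_linear {α : Type} (t : LGrpTerm α) :
    ∃ F : Finset ((α → ℚ) →ₗ[ℚ] ℚ), ∀ w, ∃ l ∈ F, eval w t = l w := by
  classical
  induction t with
  | var a => exact ⟨{LinearMap.proj a}, fun w => ⟨_, Finset.mem_singleton_self _, rfl⟩⟩
  | zero => exact ⟨{0}, fun w => ⟨_, Finset.mem_singleton_self _, rfl⟩⟩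
  | neg t ih =>
    obtain ⟨F, hF⟩ := ih
    refine ⟨F.image Neg.neg, fun w => ?_⟩
    obtain ⟨l, hl, h⟩ := hF w
    exact ⟨-l, Finset.mem_image_of_mem _ hl, by simp [eval, h]⟩
  | add s t ihs iht =>
    obtain ⟨F, hF⟩ := ihs
    obtain ⟨E, hE⟩ := iht
    refine ⟨(F ×ˢ E).image fun p => p.1 + p.2, fun w => ?_⟩
    obtain ⟨l, hl, h⟩ := hF w
    obtain ⟨k, hk, h'⟩ := hE w
    exact ⟨l + k, Finset.mem_image.2 ⟨(l, k), Finset.mk_mem_product hl hk, rfl⟩,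
      by simp [eval, h, h']⟩
  | sup s t ihs iht =>
    obtain ⟨F, hF⟩ := ihs
    obtain ⟨E, hE⟩ := iht
    refine ⟨F ∪ E, fun w => ?_⟩
    obtain ⟨l, hl, h⟩ := hF w
    obtain ⟨k, hk, h'⟩ := hE w
    rcases le_total (eval w s) (eval w t) with hle | hle
    · exact ⟨k, Finset.mem_union_right _ hk, by rw [eval, sup_eq_right.2 hle, h']⟩
    · exact ⟨l, Finset.mem_union_left _ hl, by rw [eval, sup_eq_left.2 hle, h]⟩

variable {n m : ℕ} {δ : LGrpTerm (Fin n ⊕ Fin m)}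

/-- The function implicitly defined by a uniquely solvable equation is piecewise linear. -/
theorem exists_finset_linear_solutions (hδ : UniquelySolvable δ ℚ) :
    ∃ L : Finset ((Fin n → ℚ) →ₗ[ℚ] (Fin m → ℚ)),
      ∀ x, ∃ l ∈ L, eval (Sum.elim x (l x)) δ = 0 := by
  classical
  obtain ⟨F, hF⟩ := exists_finset_linear δ
  let J := (LinearEquiv.sumArrowLequivProdArrow (Fin n) (Fin m) ℚ ℚ).symm
  have hJ : ∀ x z, J (x, z) = Sum.elim x z := fun x z => rfl
  have hsol : ∀ E : Finset ((Fin n ⊕ Fin m → ℚ) →ₗ[ℚ] ℚ),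
      ∃ f : (Fin n → ℚ) →ₗ[ℚ] (Fin m → ℚ),
        (∀ v, (∀ l ∈ E, l (Sum.elim 0 v) = 0) → v = 0) →
          ∀ x z, (∀ l ∈ E, l (Sum.elim x z) = 0) → z = f x := by
    intro E
    let A : (Fin n → ℚ) →ₗ[ℚ] (E → ℚ) :=
      LinearMap.pi fun l => l.1 ∘ₗ J.toLinearMap ∘ₗ LinearMap.inl ℚ _ _
    let B : (Fin m → ℚ) →ₗ[ℚ] (E → ℚ) :=
      LinearMap.pi fun l => l.1 ∘ₗ J.toLinearMap ∘ₗ LinearMap.inr ℚ _ _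
    by_cases hinj : ∀ v, (∀ l ∈ E, l (Sum.elim 0 v) = 0) → v = 0
    · have hker : LinearMap.ker B = ⊥ := by
        refine LinearMap.ker_eq_bot'.2 fun v hv => hinj v fun l hl => ?_
        exact congrFun hv ⟨l, hl⟩
      obtain ⟨M, hM⟩ := LinearMap.exists_leftInverse_of_injective B hker
      refine ⟨-(M ∘ₗ A), fun _ x z hxz => ?_⟩
      have hAB : A x + B z = 0 := by
        ext l
        have h := hxz l.1 l.2
        have hsum : Sum.elim x z = J (x, 0) + J (0, z) := by
          rw [← map_add, Prod.mk_add_mk, add_zero, zero_add, hJ]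
        rw [hsum, map_add] at h
        exact h
      calc z = M (B z) := (LinearMap.congr_fun hM z).symm
        _ = _ := by rw [eq_neg_of_add_eq_zero_right hAB, map_neg]; rfl
    · exact ⟨0, fun h => absurd h hinj⟩
  choose f hf using hsol
  refine ⟨F.powerset.image f, fun x => ?_⟩
  obtain ⟨z, hz, huniq⟩ := hδ x
  let E := F.filter fun l => l (Sum.elim x z) = 0
  refine ⟨f E, Finset.mem_image_of_mem _ (Finset.mem_powerset.2 (Finset.filter_subset _ _)), ?_⟩
  rw [← hf E ?_ x z fun l hl => (Finset.mem_filter.1 hl).2]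
  · exact hz
  intro v hv
  let γ : ℚ → Fin n ⊕ Fin m → ℚ := fun ε => Sum.elim x z + ε • Sum.elim (0 : Fin n → ℚ) v
  have hγ : Continuous γ := by fun_prop
  have hγ0 : γ 0 = Sum.elim x z := by simp [γ]
  have hev : ∀ᶠ ε in 𝓝 (0 : ℚ), ∀ l ∈ F.filter (fun l => l (Sum.elim x z) ≠ 0),
      eval (γ ε) δ - l (γ ε) ≠ 0 := by
    rw [Filter.eventually_all_finset]
    intro l hl
    have hcont : Continuous fun ε => eval (γ ε) δ - l (γ ε) :=
      ((continuous_eval δ).comp hγ).sub ((LinearMap.continuous_on_pi l).comp hγ)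
    refine hcont.continuousAt.eventually_ne ?_
    rw [hγ0, hz, zero_sub, neg_ne_zero]
    exact (Finset.mem_filter.1 hl).2
  obtain ⟨ε, hε, hε0⟩ := ((hev.filter_mono nhdsWithin_le_nhds).and
    (self_mem_nhdsWithin : {ε : ℚ | ε ≠ 0} ∈ 𝓝[≠] (0 : ℚ))).exists
  have hγε : γ ε = Sum.elim x (z + ε • v) := by
    ext i; rcases i with i | i <;> simp [γ]
  have hδε : eval (γ ε) δ = 0 := by
    obtain ⟨l, hl, h⟩ := hF (γ ε)
    have hl0 : l (Sum.elim x z) = 0 := by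
      by_contra hne
      exact hε l (Finset.mem_filter.2 ⟨hl, hne⟩) (sub_eq_zero.2 h)
    rw [h, map_add, map_smul, hl0, hv l (Finset.mem_filter.2 ⟨hl, hl0⟩), smul_zero, add_zero]
  rw [hγε] at hδε
  have := huniq _ hδε
  rw [add_eq_left] at this
  exact (smul_eq_zero.1 this).resolve_left hε0

theorem isOpen_and_dense_setOf_forall_ne_zero {V W : Type*} [AddCommGroup V] [Module ℚ V]
    [TopologicalSpace V] [ContinuousAdd V] [ContinuousSMul ℚ V] [AddCommGroup W] [Module ℚ W]
    [TopologicalSpace W] [T1Space W] (s : Finset (V →ₗ[ℚ] W)) (hs : ∀ f ∈ s, Continuous f)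
    (hs0 : ∀ f ∈ s, f ≠ 0) :
    IsOpen {x | ∀ f ∈ s, f x ≠ 0} ∧ Dense {x | ∀ f ∈ s, f x ≠ 0} := by
  classical
  induction s using Finset.induction_on with
  | empty => simp
  | insert f s _ ih =>
    obtain ⟨ho, hd⟩ := ih (fun g hg => hs g (Finset.mem_insert_of_mem hg))
      (fun g hg => hs0 g (Finset.mem_insert_of_mem hg))
    have hf := hs f (Finset.mem_insert_self _ _)
    have hset : {x | ∀ g ∈ insert f s, g x ≠ 0} =
        (LinearMap.ker f : Set V)ᶜ ∩ {x | ∀ g ∈ s, g x ≠ 0} := by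
      ext x; simp
    have hclosed : IsClosed (LinearMap.ker f : Set V) := isClosed_singleton.preimage hf
    have hdense : Dense (LinearMap.ker f : Set V)ᶜ := by
      rw [← interior_eq_empty_iff_dense_compl, ← Set.not_nonempty_iff_eq_empty]
      intro hne
      have hunit : {x : ℚ | IsUnit x} = {0}ᶜ := by ext x; simp
      have : (𝓝[{x : ℚ | IsUnit x}] 0).NeBot := by rw [hunit]; infer_instance
      exact hs0 f (Finset.mem_insert_self _ _)
        (LinearMap.ker_eq_top.1 (Submodule.eq_top_of_nonempty_interior' _ hne))
    rw [hset]
    exact ⟨hclosed.isOpen_compl.inter ho, hdense.inter_of_isOpen_right hd ho⟩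

/-- If the function implicitly defined by `δ` sends integral points to `R`-points, then its linear
pieces can be taken with coefficients in `R`. -/
theorem exists_finset_linear_solutions_mem (hδ : UniquelySolvable δ ℚ) (R : AddSubgroup ℚ)
    (hR : ∀ (x : Fin n → ℤ) (z : Fin m → ℚ),
      eval (Sum.elim (fun i => (x i : ℚ)) z) δ = 0 → ∀ j, z j ∈ R) :
    ∃ L : Finset ((Fin n → ℚ) →ₗ[ℚ] (Fin m → ℚ)),
      (∀ l ∈ L, ∀ i j, l (Pi.single i 1) j ∈ R) ∧
      ∀ x, ∃ l ∈ L, eval (Sum.elim x (l x)) δ = 0 := by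
  classical
  obtain ⟨L, hL⟩ := exists_finset_linear_solutions hδ
  have hcont : ∀ l : (Fin n → ℚ) →ₗ[ℚ] (Fin m → ℚ),
      Continuous fun x => eval (Sum.elim x (l x)) δ := by
    intro l
    refine (continuous_eval δ).comp (continuous_pi fun i => ?_)
    rcases i with i | i
    · exact continuous_apply i
    · exact (continuous_apply i).comp (LinearMap.continuous_on_pi l)
  let L' := L.filter fun l => ∀ i j, l (Pi.single i 1) j ∈ R
  refine ⟨L', fun l hl => (Finset.mem_filter.1 hl).2, ?_⟩
  have hclosed : IsClosed {x | ∃ l ∈ L', eval (Sum.elim x (l x)) δ = 0} := by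
    have : {x | ∃ l ∈ L', eval (Sum.elim x (l x)) δ = 0} =
        ⋃ l ∈ L', {x | eval (Sum.elim x (l x)) δ = 0} := by ext x; simp
    rw [this]
    exact L'.finite_toSet.isClosed_biUnion fun l _ => isClosed_singleton.preimage (hcont l)
  have hdense := (isOpen_and_dense_setOf_forall_ne_zero
    (((L ×ˢ L).filter fun p => p.1 ≠ p.2).image fun p => p.1 - p.2)
    (fun f _ => LinearMap.continuous_on_pi f) (by
      intro f hf
      obtain ⟨p, hp, rfl⟩ := Finset.mem_image.1 hf
      exact sub_ne_zero.2 (Finset.mem_filter.1 hp).2)).2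
  suffices hsub : {x | ∀ f ∈ ((L ×ˢ L).filter fun p => p.1 ≠ p.2).image (fun p => p.1 - p.2),
      f x ≠ 0} ⊆ {x | ∃ l ∈ L', eval (Sum.elim x (l x)) δ = 0} by
    intro x
    exact (hclosed.closure_subset_iff.2 hsub) (hdense x)
  intro x hx
  obtain ⟨l, hl, hlx⟩ := hL x
  refine ⟨l, Finset.mem_filter.2 ⟨hl, fun i j => ?_⟩, hlx⟩
  have hne : ∀ᶠ y in 𝓝 x, ∀ k ∈ L.filter (fun k => k ≠ l), eval (Sum.elim y (k y)) δ ≠ 0 := by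
    rw [Filter.eventually_all_finset]
    intro k hk
    obtain ⟨hkL, hkl⟩ := Finset.mem_filter.1 hk
    refine (hcont k).continuousAt.eventually_ne fun hkx => ?_
    refine hx (k - l) (Finset.mem_image.2 ⟨(k, l),
      Finset.mem_filter.2 ⟨Finset.mk_mem_product hkL hl, hkl⟩, rfl⟩) ?_
    rw [LinearMap.sub_apply, sub_eq_zero]
    exact (hδ x).unique hkx hlx
  have hnear : ∀ᶠ y in 𝓝 x, eval (Sum.elim y (l y)) δ = 0 := by
    filter_upwards [hne] with y hy
    obtain ⟨k, hk, hky⟩ := hL y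
    by_cases hkl : k = l
    · exact hkl ▸ hky
    · exact absurd hky (hy k (Finset.mem_filter.2 ⟨hk, hkl⟩))
  obtain ⟨N, hN, -, a, ha⟩ := exists_nat_mul_eq_intCast x
  have hlim : Tendsto (fun t : ℕ => x + ((N : ℚ)⁻¹ * (1 / ((t : ℚ) + 1))) • Pi.single i (1 : ℚ))
      atTop (𝓝 x) := by
    have h0 := (tendsto_one_div_add_atTop_nhds_zero_nat (𝕜 := ℚ)).const_mul (N : ℚ)⁻¹
    rw [mul_zero] at h0
    have := (h0.smul_const (Pi.single i (1 : ℚ) : Fin n → ℚ)).const_add x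
    rwa [zero_smul, add_zero] at this
  obtain ⟨t, ht⟩ := (hlim.eventually hnear).exists
  have hmem : ∀ (y : Fin n → ℚ) (b : Fin n → ℤ), eval (Sum.elim y (l y)) δ = 0 →
      ((N * (t + 1) : ℕ) : ℚ) • y = (fun i => (b i : ℚ)) → l (fun i => (b i : ℚ)) j ∈ R := by
    intro y b hy hyb
    refine hR b _ ?_ j
    have := eval_rat_mul (q := ((N * (t + 1) : ℕ) : ℚ)) (Nat.cast_nonneg _)
      (Sum.elim y (l y)) δ
    rw [hy, mul_zero] at this
    rw [← this, ← hyb, map_smul]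
    congr 1
    ext i; rcases i with i | i <;> rfl
  have hNq : (N : ℚ) ≠ 0 := Nat.cast_ne_zero.2 hN
  have htq : (t : ℚ) + 1 ≠ 0 := by positivity
  have h1 := hmem x (fun i => (t + 1) * a i) hlx (by
    ext i
    simp only [Pi.smul_apply, smul_eq_mul]
    push_cast
    rw [← ha i]; ring)
  have h2 := hmem _ (fun i' => (t + 1) * a i' + Pi.single (M := fun _ => ℤ) i 1 i') ht (by
    ext i'
    simp only [Pi.smul_apply, Pi.add_apply, smul_eq_mul]
    push_cast
    rw [← ha i']
    by_cases h : i' = i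
    · subst h
      simp only [Pi.single_eq_same]
      field_simp
      push_cast
      ring
    · simp [Pi.single_eq_of_ne h]; ring)
  have h3 := R.sub_mem h2 h1
  rw [← Pi.sub_apply, ← map_sub] at h3
  convert h3 using 3
  ext i'
  by_cases h : i' = i
  · subst h; simp
  · simp [Pi.single_eq_of_ne h]

end PiecewiseLinear

section Transfer

open LGrpTerm

theorem exists_nsmul_eq_of_forall_prime {G : Type*} [AddCommGroup G] {S : Set ℕ}
    (hG : ∀ p ∈ S, ∀ x : G, ∃ z, p • z = x) {N : ℕ} (hN : N ≠ 0)
    (hNS : ∀ p : ℕ, p.Prime → p ∣ N → p ∈ S) (x : G) : ∃ z, N • z = x := by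
  induction N using Nat.recOnMul generalizing x with
  | zero => exact absurd rfl hN
  | one => exact ⟨x, one_smul _ _⟩
  | prime p hp => exact hG p (hNS p hp dvd_rfl) x
  | mul a b iha ihb =>
    obtain ⟨ha, hb⟩ := mul_ne_zero_iff.1 hN
    obtain ⟨y, hy⟩ := iha ha (fun p hp h => hNS p hp (h.mul_right b)) x
    obtain ⟨z, hz⟩ := ihb hb (fun p hp h => hNS p hp (h.mul_left a)) y
    exact ⟨z, by rw [mul_smul, hz, hy]⟩

/-- The rational numbers whose denominator has all its prime factors in `S`. -/
def localizedInt (S : Set ℕ) : AddSubgroup ℚ where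
  carrier := {q | ∀ p : ℕ, p.Prime → p ∣ q.den → p ∈ S}
  zero_mem' := fun _ hp h => absurd (Nat.dvd_one.1 h) hp.ne_one
  add_mem' := fun {a b} ha hb p hp h =>
    (hp.dvd_mul.1 (h.trans (Rat.add_den_dvd a b))).elim (ha p hp) (hb p hp)
  neg_mem' := fun {a} ha p hp h => ha p hp (by rwa [Rat.neg_den] at h)

theorem mem_localizedInt {S : Set ℕ} {q : ℚ} :
    q ∈ localizedInt S ↔ ∀ p : ℕ, p.Prime → p ∣ q.den → p ∈ S :=
  Iff.rfl

theorem natCast_inv_mem_localizedInt {S : Set ℕ} {p : ℕ} (hp : p.Prime) :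
    (p : ℚ)⁻¹ ∈ localizedInt S ↔ p ∈ S := by
  rw [mem_localizedInt, Rat.inv_natCast_den_of_pos hp.pos]
  refine ⟨fun h => h p hp dvd_rfl, fun h q hq hqp => ?_⟩
  rwa [(Nat.prime_dvd_prime_iff_eq hq hp).1 hqp]

theorem localizedInt_nsmul_surjective {S : Set ℕ} {p : ℕ} (hp : p.Prime) (hpS : p ∈ S)
    (x : localizedInt S) : ∃ z : localizedInt S, p • z = x := by
  refine ⟨⟨(p : ℚ)⁻¹ * x, fun q hq h => ?_⟩, Subtype.ext ?_⟩
  · rcases hq.dvd_mul.1 (h.trans (Rat.mul_den_dvd _ _)) with h | h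
    · exact (natCast_inv_mem_localizedInt hp).2 hpS q hq h
    · exact x.2 q hq h
  · rw [AddSubgroup.coe_nsmul, nsmul_eq_mul, mul_inv_cancel_left₀ (Nat.cast_ne_zero.2 hp.ne_zero)]

theorem exists_nsmul_eq_of_exists_den_nsmul_eq {G : Type*} [AddCommGroup G] {q : ℚ} {p : ℕ}
    (hpq : p ∣ q.den) (hG : ∀ g : G, ∃ h : G, q.den • h = q.num • g) (g : G) :
    ∃ h : G, p • h = g := by
  obtain ⟨h, hh⟩ := hG g
  obtain ⟨d, hd⟩ := hpq
  have hcop : IsCoprime q.num (p : ℤ) := by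
    have : IsCoprime q.num (q.den : ℤ) := by
      rw [Int.isCoprime_iff_gcd_eq_one]; exact q.reduced
    rw [hd, Nat.cast_mul] at this
    exact this.of_mul_right_left
  obtain ⟨a, b, hab⟩ := hcop
  refine ⟨a • d • h + b • g, ?_⟩
  rw [hd, mul_smul] at hh
  rw [smul_add, smul_comm p a, hh, ← natCast_zsmul, smul_smul, smul_smul, ← add_smul,
    mul_comm (p : ℤ) b, hab, one_smul]

variable {n m : ℕ} {δ : LGrpTerm (Fin n ⊕ Fin m)}

/-- Uniqueness of solutions over `ℚ` is witnessed by a linear bound in every abelian ℓ-group. -/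
theorem UniquelySolvable.exists_abs_sub_le (hδ : UniquelySolvable δ ℚ) {H : Type} [Lattice H]
    [AddCommGroup H] [IsOrderedAddMonoid H] (x : Fin n → H) (z z' : Fin m → H) (j : Fin m) :
    ∃ N : ℕ, |z j - z' j| ≤ N • (|eval (Sum.elim x z) δ| + |eval (Sum.elim x z') δ|) := by
  classical
  by_contra! hN
  obtain ⟨T, _, _, _, π, hsup, hπ, hπ'⟩ := exists_linear_quotient
    (|eval (Sum.elim x z) δ| + |eval (Sum.elim x z') δ|) (z j - z' j)
    (add_nonneg (abs_nonneg _) (abs_nonneg _)) hN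
  have habs : ∀ a, π |a| = |π a| := fun a => by rw [abs, abs, hsup, map_neg]
  rw [map_add, habs, habs, add_eq_zero_iff_of_nonneg (abs_nonneg _) (abs_nonneg _), abs_eq_zero,
    abs_eq_zero] at hπ
  let f : Fin n ⊕ Fin m → Fin n ⊕ (Fin m ⊕ Fin m) := Sum.map id Sum.inl
  let f' : Fin n ⊕ Fin m → Fin n ⊕ (Fin m ⊕ Fin m) := Sum.map id Sum.inr
  let w : Fin n ⊕ (Fin m ⊕ Fin m) → H := Sum.elim x (Sum.elim z z')
  obtain ⟨y, hy, hΛ⟩ := exists_rat_point (π ∘ w) {rename f δ, rename f' δ}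
    {Pi.single (.inr (.inl j)) 1 - Pi.single (.inr (.inr j)) 1}
  have h1 : eval (y ∘ f) δ = 0 := by
    rw [← eval_rename, ← hy _ (by simp), eval_comp π hsup, eval_rename]
    convert hπ.1 using 3
    ext i; rcases i with i | i <;> rfl
  have h2 : eval (y ∘ f') δ = 0 := by
    rw [← eval_rename, ← hy _ (by simp), eval_comp π hsup, eval_rename]
    convert hπ.2 using 3
    ext i; rcases i with i | i <;> rfl
  have h3 := (hΛ _ (Finset.mem_singleton_self _)).eq_zero_iff
  simp only [Pi.sub_apply, Pi.single_apply, sub_smul, ite_smul, one_smul, zero_smul,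
    Finset.sum_ite_eq', Finset.sum_sub_distrib, Finset.mem_univ, if_true, Int.cast_sub,
    Int.cast_ite, Int.cast_one, Int.cast_zero, sub_mul, ite_mul, one_mul, zero_mul] at h3
  refine hπ' ?_
  rw [map_sub]
  refine h3.2 (sub_eq_zero.2 ?_)
  refine congrFun ((hδ (y ∘ Sum.inl)).unique (y₁ := y ∘ Sum.inr ∘ Sum.inl)
    (y₂ := y ∘ Sum.inr ∘ Sum.inr) ?_ ?_) j
  · convert h1 using 2
    ext i; rcases i with i | i <;> rfl
  · convert h2 using 2
    ext i; rcases i with i | i <;> rfl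

theorem exists_eval_eq_zero_of_linear_pieces {L : Finset ((Fin n → ℚ) →ₗ[ℚ] (Fin m → ℚ))}
    (hL : ∀ x, ∃ l ∈ L, eval (Sum.elim x (l x)) δ = 0) {T : Type*} [AddCommGroup T]
    [LinearOrder T] [IsOrderedAddMonoid T] {D : L → Fin m → ℕ} (hD : ∀ l j, D l j ≠ 0)
    {A : L → Fin m → Fin n → ℤ} (hA : ∀ l j i, (D l j : ℚ) * l.1 (Pi.single i 1) j = A l j i)
    (x : Fin n → T) (u : L → Fin m → T) (hu : ∀ l j, D l j • u l j = ∑ i, A l j i • x i) :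
    ∃ l, eval (Sum.elim x (u l)) δ = 0 := by
  classical
  let f : L → Fin n ⊕ Fin m → Fin n ⊕ (L × Fin m) := fun l => Sum.map id (Prod.mk l)
  let w : Fin n ⊕ (L × Fin m) → T := Sum.elim x fun k => u k.1 k.2
  let c : L × Fin m → Fin n ⊕ (L × Fin m) → ℤ := fun k =>
    Sum.elim (fun i => -A k.1 k.2 i) (Pi.single k (D k.1 k.2 : ℤ))
  obtain ⟨y, hy, hΛ⟩ := exists_rat_point w (Finset.univ.image fun l => rename (f l) δ)
    (Finset.univ.image c)
  have hyl : ∀ k : L × Fin m, y (.inr k) = k.1.1 (y ∘ Sum.inl) k.2 := by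
    intro k
    have h := (hΛ (c k) (Finset.mem_image_of_mem _ (Finset.mem_univ k))).eq_zero_iff
    simp only [c, w, Fintype.sum_sum_type, Sum.elim_inl, Sum.elim_inr, Pi.single_apply, neg_smul,
      Finset.sum_neg_distrib, ite_smul, zero_smul, Finset.sum_ite_eq', Finset.mem_univ, if_true,
      Int.cast_neg, neg_mul, Int.cast_ite, Int.cast_zero, ite_mul, zero_mul, Int.cast_natCast,
      natCast_zsmul, hu, neg_add_cancel, true_iff, ← hA] at h
    refine mul_left_cancel₀ (Nat.cast_ne_zero.2 (hD k.1 k.2) : (D k.1 k.2 : ℚ) ≠ 0) ?_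
    rw [← sub_eq_zero, ← h, LinearMap.pi_apply_eq_sum_univ k.1.1, Finset.sum_apply,
      Finset.mul_sum, neg_add_eq_sub]
    congr 1
    refine Finset.sum_congr rfl fun i _ => ?_
    have : (fun j => if i = j then (1 : ℚ) else 0) = Pi.single i 1 := by
      ext j; simp [Pi.single_apply, eq_comm]
    rw [this, Pi.smul_apply, smul_eq_mul, Function.comp_apply]
    ring
  obtain ⟨l, hl, hlx⟩ := hL (y ∘ Sum.inl)
  refine ⟨⟨l, hl⟩, ?_⟩
  have h := hy (rename (f ⟨l, hl⟩) δ) (Finset.mem_image_of_mem _ (Finset.mem_univ _))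
  rw [eval_rename, eval_rename] at h
  have hw : w ∘ f ⟨l, hl⟩ = Sum.elim x (u ⟨l, hl⟩) := by
    ext i; rcases i with i | i <;> rfl
  have hy' : y ∘ f ⟨l, hl⟩ = Sum.elim (y ∘ Sum.inl) (l (y ∘ Sum.inl)) := by
    ext i
    rcases i with i | i
    · rfl
    · exact hyl (⟨l, hl⟩, i)
  rw [hw, hy'] at h
  exact h.2 hlx

/-- Unique solvability passes from `ℚ` to every ℓ-group divisible by the primes occurring in the
denominators of solutions over integral points. -/
theorem UniquelySolvable.of_rat (hδ : UniquelySolvable δ ℚ) {S : Set ℕ}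
    (hS : ∀ (x : Fin n → ℤ) (z : Fin m → ℚ),
      eval (Sum.elim (fun i => (x i : ℚ)) z) δ = 0 → ∀ j, z j ∈ localizedInt S)
    {H : Type} [Lattice H] [AddCommGroup H] [IsOrderedAddMonoid H]
    (hH : ∀ p ∈ S, ∀ x : H, ∃ z, p • z = x) : UniquelySolvable δ H := by
  classical
  obtain ⟨L, hLS, hL⟩ := exists_finset_linear_solutions_mem hδ _ hS
  choose D hD hDS A hA using fun (l : L) (j : Fin m) =>
    exists_nat_mul_eq_intCast fun i : Fin n => l.1 (Pi.single i 1) j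
  intro x
  have hdiv : ∀ l j, ∃ u, D l j • u = ∑ i, A l j i • x i := fun l j =>
    exists_nsmul_eq_of_forall_prime hH (hD l j)
      (fun p hp h => (hDS l j p hp h).elim fun i hi => hLS l l.2 i j p hp hi) _
  choose u hu using hdiv
  let d : L → H := fun l => eval (Sum.elim x (u l)) δ
  choose N hN using fun (l l' : L) (j : Fin m) => hδ.exists_abs_sub_le x (u l) (u l') j
  let N₀ := ∑ l, ∑ l', ∑ j, N l l' j
  have hN₀ : ∀ l l' j, N l l' j ≤ N₀ := fun l l' j =>
    (Finset.single_le_sum (f := fun j => N l l' j) (fun _ _ => Nat.zero_le _)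
      (Finset.mem_univ j)).trans <|
    (Finset.single_le_sum (f := fun l' => ∑ j, N l l' j) (fun _ _ => Nat.zero_le _)
      (Finset.mem_univ l')).trans <|
    Finset.single_le_sum (f := fun l => ∑ l', ∑ j, N l l' j) (fun _ _ => Nat.zero_le _)
      (Finset.mem_univ l)
  have hne : (Finset.univ : Finset L).Nonempty := by
    obtain ⟨l, hl, -⟩ := hL 0
    exact ⟨⟨l, hl⟩, Finset.mem_univ _⟩
  let z : Fin m → H := fun j => Finset.univ.sup' hne fun l => u l j - N₀ • |d l|
  have hz_ge : ∀ l j, u l j - N₀ • |d l| ≤ z j := fun l j =>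
    Finset.le_sup' (fun l => u l j - N₀ • |d l|) (Finset.mem_univ l)
  have hz_le : ∀ l j, z j ≤ u l j + N₀ • |d l| := by
    intro l j
    refine Finset.sup'_le _ _ fun l' _ => ?_
    rw [sub_le_iff_le_add, add_assoc, ← smul_add, add_comm |d l|, ← sub_le_iff_le_add']
    exact (le_abs_self _).trans ((hN l' l j).trans
      (nsmul_le_nsmul_left (add_nonneg (abs_nonneg _) (abs_nonneg _)) (hN₀ l' l j)))
  have hz : eval (Sum.elim x z) δ = 0 := by
    by_contra hne0
    obtain ⟨T, _, _, _, π, hsup, hπ⟩ := exists_linear_quotient_of_ne_zero _ hne0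
    have hmono : Monotone π := fun a b hab => by
      rw [← sup_eq_right.2 hab, hsup]; exact le_sup_left
    obtain ⟨l, hl⟩ := exists_eval_eq_zero_of_linear_pieces hL hD hA (π ∘ x) (fun l => π ∘ u l)
      fun l j => by simp only [Function.comp_apply, ← map_nsmul, ← map_zsmul, ← map_sum, hu]
    rw [← Sum.comp_elim, eval_comp π hsup] at hl
    have hd : π (N₀ • |d l|) = 0 := by
      rw [map_nsmul, abs, hsup, map_neg]
      change N₀ • (π (eval _ δ) ⊔ -π (eval _ δ)) = 0
      rw [hl, neg_zero, sup_idem, smul_zero]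
    have hπz : π ∘ z = π ∘ u l := by
      ext j
      refine le_antisymm ?_ ?_
      · simpa [hd] using hmono (hz_le l j)
      · simpa [hd] using hmono (hz_ge l j)
    apply hπ
    rw [← eval_comp π hsup, Sum.comp_elim, hπz, ← Sum.comp_elim, eval_comp π hsup, hl]
  refine ⟨z, hz, fun z' hz' => funext fun j => ?_⟩
  obtain ⟨M, hM⟩ := hδ.exists_abs_sub_le x z' z j
  rw [hz, hz', abs_zero, add_zero, smul_zero] at hM
  refine le_antisymm (sub_nonpos.1 ((le_abs_self _).trans hM)) (sub_nonpos.1 ?_)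
  rw [← neg_sub]
  exact (neg_le_abs _).trans hM

end Transfer

theorem isOrderedAddMonoid_of_covariantClass {G : Type*} [AddCommGroup G] [Lattice G]
    [CovariantClass G G (· + ·) (· ≤ ·)] : IsOrderedAddMonoid G :=
  { add_le_add_left := fun _ _ h c => by
      rw [add_comm _ c, add_comm _ c]
      exact CovariantClass.elim c h }

/-- Every set `Sig` of EFD-sentences either has only trivial abelian ℓ-group models, or is
equivalent over abelian ℓ-groups to `Σ_S = {δ_p : p ∈ S}` for a unique set `S` of primes. -/
theorem efd_set_classification (Sig : Set (EFDSystem LGrpLang)) :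
    (∀ (G : Type) [Lattice G] [AddCommGroup G] [CovariantClass G G (· + ·) (· ≤ ·)],
        (∀ φ ∈ Sig, φ.Satisfies G) → Subsingleton G) ∨
    (∃! S : Set ℕ, (∀ p ∈ S, Nat.Prime p) ∧
      ∀ (G : Type) [Lattice G] [AddCommGroup G] [CovariantClass G G (· + ·) (· ≤ ·)],
        (∀ φ ∈ Sig, φ.Satisfies G) ↔ (∀ p ∈ S, ∀ x : G, ∃! z : G, p • z = x)) := by
  refine or_iff_not_imp_left.2 fun htriv => ?_
  push Not at htriv
  obtain ⟨G₀, _, _, _, hG₀, hne⟩ := htriv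
  have : IsOrderedAddMonoid G₀ := isOrderedAddMonoid_of_covariantClass
  obtain ⟨g, hg, hg0⟩ :=
    (eq_zero_or_exists_pos G₀).resolve_left (not_subsingleton_iff_nontrivial.2 hne)
  let S : Set ℕ := {p | p.Prime ∧ ∀ (G : Type) [Lattice G] [AddCommGroup G]
    [CovariantClass G G (· + ·) (· ≤ ·)], (∀ φ ∈ Sig, φ.Satisfies G) → ∀ x : G, ∃ z, p • z = x}
  refine ⟨S, ⟨fun p hp => hp.1, fun G _ _ _ => ⟨fun hG p hp x => ?_, fun hG φ hφ => ?_⟩⟩,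
    fun S' ⟨hS'p, hS'⟩ => ?_⟩
  · have : IsOrderedAddMonoid G := isOrderedAddMonoid_of_covariantClass
    obtain ⟨z, hz⟩ := hp.2 G hG x
    exact ⟨z, hz, fun z' hz' => eq_of_nsmul_eq_nsmul hp.1.ne_zero (hz'.trans hz.symm)⟩
  · have : IsOrderedAddMonoid G := isOrderedAddMonoid_of_covariantClass
    obtain ⟨δ, hδ⟩ := φ.exists_satisfies_iff
    have hδℚ : UniquelySolvable δ ℚ := fun x => by
      have h₀ := (hδ G₀).1 (hG₀ φ hφ)
      obtain ⟨z, hz⟩ := h₀.exists_rat hg hg0 x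
      exact ⟨z, hz, fun z' hz' => h₀.eq_of_rat hg hg0 hz' hz⟩
    refine (hδ G).2 (hδℚ.of_rat (S := S) (fun x z hz j p hp hpz => ⟨hp, fun K _ _ _ hK => ?_⟩)
      fun p hp y => (hG p hp y).exists)
    have : IsOrderedAddMonoid K := isOrderedAddMonoid_of_covariantClass
    exact exists_nsmul_eq_of_exists_den_nsmul_eq hpz fun y =>
      ((hδ K).1 (hK φ hφ)).exists_nsmul_eq hz y j
  · refine Set.Subset.antisymm
      (fun p hp => ⟨hS'p p hp, fun G _ _ _ hG x => ((hS' G).1 hG p hp x).exists⟩) fun p hp => ?_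
    have hmodel : ∀ φ ∈ Sig, φ.Satisfies (localizedInt S') := by
      refine (hS' _).2 fun q hq x => ?_
      obtain ⟨z, hz⟩ := localizedInt_nsmul_surjective (hS'p q hq) hq x
      exact ⟨z, hz, fun z' hz' =>
        eq_of_nsmul_eq_nsmul (hS'p q hq).ne_zero (hz'.trans hz.symm)⟩
    have h1 : (1 : ℚ) ∈ localizedInt S' := fun q hq h => absurd (Nat.dvd_one.1 h) hq.ne_one
    obtain ⟨z, hz⟩ := hp.2 _ hmodel ⟨1, h1⟩
    have hz' : (p : ℚ) * z = 1 := by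
      rw [← nsmul_eq_mul]; exact congrArg Subtype.val hz
    rw [← natCast_inv_mem_localizedInt hp.1, ← eq_inv_of_mul_eq_one_right hz']
    exact z.2
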